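/- Let X be a geodesic δ-hyperbolic metric space, let G be a group that is not virtually cyclic acting on X by isometries with a unital axial WPD loxodromic element f ∈ G, let x₀ ∈ Ax(f), and let S be a finite generating set of G. Then there exists D₀ > 0 such that for each ε > 0 and each integer D > D₀ there exists a constant N = N(ε,D) such that for every finite set A ⊆ G there exists A' ⊆ A satisfying: (1) #A' ≥ (1−ε)·#A; and (2) for each a ∈ A' there exists b ∈ G with d_S(a,b) ≤ N and #({gx₀ : g ∈ A} \ H_half(bx₀, b f^D x₀)) ≤ N. -/

import Mathlib

noncomputable section

open Set Metric Pointwise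

/-- The Gromov product `(y|z)_x`. -/
def gromovProd {X : Type*} [MetricSpace X] (x y z : X) : ℝ :=
  (dist x y + dist x z - dist y z) / 2

/-- `γ` restricted to `[a, b]` is a unit-speed geodesic. -/
def IsGeodesicParam {X : Type*} [MetricSpace X] (γ : ℝ → X) (a b : ℝ) : Prop :=
  ∀ s ∈ Set.Icc a b, ∀ t ∈ Set.Icc a b, dist (γ s) (γ t) = |s - t|

/-- `γ` is a geodesic from `x` to `y`, parametrized by arclength on `[0, dist x y]`. -/
def IsGeodesicBetween {X : Type*} [MetricSpace X] (γ : ℝ → X) (x y : X) : Prop :=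
  γ 0 = x ∧ γ (dist x y) = y ∧ IsGeodesicParam γ 0 (dist x y)

/-- A geodesic metric space: any two points are joined by a geodesic. -/
def GeodesicSpace (X : Type*) [MetricSpace X] : Prop :=
  ∀ x y : X, ∃ γ : ℝ → X, IsGeodesicBetween γ x y

/-- A geodesic space in which every geodesic triangle is `δ`-thin. -/
def GromovHyperbolic (X : Type*) [MetricSpace X] (δ : ℝ) : Prop :=
  GeodesicSpace X ∧
    ∀ (x y z : X) (γ₁ γ₂ γ₃ : ℝ → X),
      IsGeodesicBetween γ₁ x z → IsGeodesicBetween γ₂ x y → IsGeodesicBetween γ₃ y z →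
        ∀ t ∈ Set.Icc (0 : ℝ) (dist x z),
          ∃ u ∈ γ₂ '' Set.Icc (0 : ℝ) (dist x y) ∪ γ₃ '' Set.Icc (0 : ℝ) (dist y z),
            dist (γ₁ t) u ≤ δ

/-- A subset of `X` which is the image of a geodesic segment. -/
def IsGeodesicSegSet {X : Type*} [MetricSpace X] (A : Set X) : Prop :=
  ∃ (γ : ℝ → X) (a b : ℝ), a ≤ b ∧ IsGeodesicParam γ a b ∧ A = γ '' Set.Icc a b

/-- The set of nearest-point projections of `x` to `A`. -/
def nearestPts {X : Type*} [MetricSpace X] (A : Set X) (x : X) : Set X :=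
  {a ∈ A | dist x a = Metric.infDist x A}

/-- The nearest-point projection of the set `B` to `A`. -/
def projSet {X : Type*} [MetricSpace X] (A B : Set X) : Set X := ⋃ x ∈ B, nearestPts A x

/-- `diam_A(B)`, the diameter of the projection of `B` to `A`. -/
def projDiam {X : Type*} [MetricSpace X] (A B : Set X) : ℝ := Metric.diam (projSet A B)

/-- `d_A(B, C) = diam (π_A (B ∪ C))`. -/
def projDist {X : Type*} [MetricSpace X] (A B C : Set X) : ℝ := Metric.diam (projSet A (B ∪ C))

/-- The halfspace `H_half(x, y)` of points at least as close to `x` as to `y`. -/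
def halfspace {X : Type*} [MetricSpace X] (x y : X) : Set X := {z | dist z x ≤ dist z y}

/-- A group is virtually cyclic if it has a cyclic subgroup of finite index. -/
def VirtuallyCyclic (G : Type*) [Group G] : Prop :=
  ∃ H : Subgroup G, H.FiniteIndex ∧ IsCyclic H

/-- The WPD property for `f` relative to the basepoint `x₀`. -/
def WPD {G : Type*} [Group G] {X : Type*} [MetricSpace X] [MulAction G X]
    (f : G) (x₀ : X) : Prop :=
  ∀ R : ℝ, 0 < R → ∃ L : ℕ, 0 < L ∧
    {g : G | dist x₀ (g • x₀) < R ∧ dist ((f ^ L) • x₀) ((g * f ^ L) • x₀) < R}.Finite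

/-- The word norm with respect to the generating set `S`. -/
def wordNorm {G : Type*} [Group G] (S : Finset G) (g : G) : ℕ :=
  sInf {n : ℕ | ∃ l : List G, l.length = n ∧ (∀ x ∈ l, x ∈ S ∨ x⁻¹ ∈ S) ∧ l.prod = g}

/-- The word metric with respect to the generating set `S`. -/
def wordDist {G : Type*} [Group G] (S : Finset G) (g h : G) : ℕ := wordNorm S (g⁻¹ * h)

/-- `B` is an `r`-roughly branching subset of `G`. -/
def RoughlyBranching {G : Type*} [Group G] (S : Finset G) (r : ℝ) (B : Set G) : Prop :=
  ∃ B' : Set G,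
    (∀ b ∈ B, ∃ b' ∈ B', (wordDist S b b' : ℝ) ≤ r) ∧
    ∀ k : ℕ, 1 ≤ k → ∀ g h : Fin k → G, (∀ i, g i ∈ B') → (∀ i, h i ∈ B') →
      (List.ofFn g).prod = (List.ofFn h).prod → g = h

/-- Gromov's four-point condition, with additive constant `c`. -/
def FourPoint (X : Type*) [MetricSpace X] (c : ℝ) : Prop :=
  ∀ x y z w : X,
    dist x y + dist z w ≤ dist x z + dist y w + c ∨ dist x y + dist z w ≤ dist x w + dist y z + c

theorem FourPoint.mono {X : Type*} [MetricSpace X] {c c' : ℝ} (h : FourPoint X c) (hc : c ≤ c') :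
    FourPoint X c' := fun x y z w =>
  (h x y z w).imp (fun h => by linarith) (fun h => by linarith)

/-- On a geodesic from `x` to `z` there is a point whose distance to `w` is at most the Gromov
product `(x|z)_w` plus `2δ`. -/
theorem GromovHyperbolic.exists_dist_le_gromovProd {X : Type*} [MetricSpace X] {δ : ℝ}
    (hX : GromovHyperbolic X δ) {x z : X} (w : X) {γ : ℝ → X} (hγ : IsGeodesicBetween γ x z) :
    ∃ t ∈ Set.Icc (0 : ℝ) (dist x z), dist w (γ t) ≤ gromovProd w x z + 2 * δ := by
  obtain ⟨γ₂, h₂⟩ := hX.1 x w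
  obtain ⟨γ₃, h₃⟩ := hX.1 w z
  have t1 := dist_triangle x z w
  have t2 := dist_triangle w x z
  have t3 := dist_triangle x w z
  have ht : (dist x w + dist x z - dist w z) / 2 ∈ Set.Icc (0 : ℝ) (dist x z) := by
    rw [dist_comm z w] at t1
    rw [dist_comm w x] at t2
    constructor <;> linarith
  have h0 : (0 : ℝ) ∈ Set.Icc (0 : ℝ) (dist x z) := ⟨le_rfl, dist_nonneg⟩
  have h1 : dist x z ∈ Set.Icc (0 : ℝ) (dist x z) := ⟨dist_nonneg, le_rfl⟩
  refine ⟨_, ht, ?_⟩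
  set t := (dist x w + dist x z - dist w z) / 2 with htdef
  have hxp : dist x (γ t) = t := by
    have := hγ.2.2 0 h0 t ht
    rw [hγ.1] at this
    rw [this, zero_sub, abs_neg, abs_of_nonneg ht.1]
  have hzp : dist z (γ t) = dist x z - t := by
    have := hγ.2.2 _ h1 t ht
    rw [hγ.2.1] at this
    rw [this, abs_of_nonneg (by linarith [ht.2])]
  obtain ⟨u, hu, hpu⟩ := hX.2 x w z γ γ₂ γ₃ hγ h₂ h₃ t ht
  have hwpu := dist_triangle w u (γ t)
  rw [dist_comm u] at hwpu
  unfold gromovProd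
  rw [dist_comm w x]
  rcases hu with ⟨s, hs, rfl⟩ | ⟨s, hs, rfl⟩
  · have e1 := h₂.2.2 0 ⟨le_rfl, dist_nonneg⟩ s hs
    have e2 := h₂.2.2 _ ⟨dist_nonneg, le_rfl⟩ s hs
    rw [h₂.1, zero_sub, abs_neg, abs_of_nonneg hs.1] at e1
    rw [h₂.2.1, abs_of_nonneg (by linarith [hs.2])] at e2
    have := dist_triangle x (γ₂ s) (γ t)
    rw [dist_comm (γ₂ s)] at this
    linarith
  · have e1 := h₃.2.2 0 ⟨le_rfl, dist_nonneg⟩ s hs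
    have e2 := h₃.2.2 _ ⟨dist_nonneg, le_rfl⟩ s hs
    rw [h₃.1, zero_sub, abs_neg, abs_of_nonneg hs.1] at e1
    rw [h₃.2.1, abs_of_nonneg (by linarith [hs.2])] at e2
    have := dist_triangle z (γ₃ s) (γ t)
    rw [dist_comm (γ₃ s)] at this
    linarith

/-- The Gromov product `(x|y)_w` is at most the distance from `w` to any point of a geodesic from
`x` to `y`. -/
theorem IsGeodesicBetween.gromovProd_le_dist {X : Type*} [MetricSpace X] {x y : X} {γ : ℝ → X}
    (hγ : IsGeodesicBetween γ x y) (w : X) {s : ℝ} (hs : s ∈ Set.Icc (0 : ℝ) (dist x y)) :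
    gromovProd w x y ≤ dist w (γ s) := by
  have e1 := hγ.2.2 0 ⟨le_rfl, dist_nonneg⟩ s hs
  have e2 := hγ.2.2 _ ⟨dist_nonneg, le_rfl⟩ s hs
  rw [hγ.1, zero_sub, abs_neg, abs_of_nonneg hs.1] at e1
  rw [hγ.2.1, abs_of_nonneg (by linarith [hs.2])] at e2
  have t1 := dist_triangle w (γ s) x
  have t2 := dist_triangle w (γ s) y
  rw [dist_comm (γ s)] at t1 t2
  unfold gromovProd
  linarith

theorem GromovHyperbolic.fourPoint {X : Type*} [MetricSpace X] {δ : ℝ}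
    (hX : GromovHyperbolic X δ) : FourPoint X (6 * δ) := by
  intro x z y w
  obtain ⟨γ, hγ⟩ := hX.1 x z
  obtain ⟨γ₂, h₂⟩ := hX.1 x y
  obtain ⟨γ₃, h₃⟩ := hX.1 y z
  obtain ⟨t, ht, hwt⟩ := hX.exists_dist_le_gromovProd w hγ
  obtain ⟨u, hu, hpu⟩ := hX.2 x y z γ γ₂ γ₃ hγ h₂ h₃ t ht
  have hwu := dist_triangle w (γ t) u
  rcases hu with ⟨s, hs, rfl⟩ | ⟨s, hs, rfl⟩
  · left
    have := h₂.gromovProd_le_dist w hs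
    simp only [gromovProd] at this hwt
    rw [dist_comm y w, dist_comm z w]
    linarith
  · right
    have := h₃.gromovProd_le_dist w hs
    simp only [gromovProd] at this hwt
    rw [dist_comm x w, dist_comm y w, dist_comm z y]
    linarith

section Parallel

variable {X : Type*} [MetricSpace X] {G : Type*} [Group G] [MulAction G X]

/-- If the orbits of `f` through `x₀` and `g • x₀` stay at bounded distance, then `g` commutes with
a positive power of `f`. -/
theorem exists_commute_pow_of_dist_le
    (hiso : ∀ (g : G) (x y : X), dist (g • x) (g • y) = dist x y)
    {f g : G} {x₀ : X} (hwpd : WPD f x₀) {R : ℝ}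
    (hR : ∀ j : ℕ, dist ((f ^ j) • x₀) ((g * f ^ j) • x₀) ≤ R) :
    ∃ k : ℕ, 0 < k ∧ Commute g (f ^ k) := by
  have hR0 : 0 ≤ R := dist_nonneg.trans (hR 0)
  obtain ⟨L, -, hfin⟩ := hwpd (R + 1) (by linarith)
  have hmem : ∀ j : ℕ, (f ^ j)⁻¹ * g * f ^ j ∈
      {g : G | dist x₀ (g • x₀) < R + 1 ∧
        dist ((f ^ L) • x₀) ((g * f ^ L) • x₀) < R + 1} := by
    intro j
    constructor
    · rw [← hiso (f ^ j), ← mul_smul, mul_assoc, mul_inv_cancel_left]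
      linarith [hR j]
    · rw [← hiso (f ^ j), ← mul_smul, ← mul_smul, mul_assoc, mul_assoc, mul_inv_cancel_left,
        ← pow_add]
      linarith [hR (j + L)]
  obtain ⟨i, -, j, -, hij, he⟩ := Set.infinite_univ.exists_lt_map_eq_of_mapsTo
    (fun j _ => hmem j) hfin
  refine ⟨j - i, by omega, ?_⟩
  have hj : f ^ j = f ^ i * f ^ (j - i) := by rw [← pow_add]; congr 1; omega
  simp only [hj, mul_inv_rev] at he
  have h2 : g * f ^ i = (f ^ (j - i))⁻¹ * g * f ^ i * f ^ (j - i) := by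
    have := congrArg (f ^ i * ·) he
    simp only [← mul_assoc, mul_inv_cancel, one_mul] at this
    have hc : f ^ i * (f ^ (j - i))⁻¹ = (f ^ (j - i))⁻¹ * f ^ i :=
      ((Commute.pow_pow_self f i (j - i)).inv_right).eq
    rw [hc] at this
    simpa only [← mul_assoc, mul_inv_cancel_right] using this
  have h3 : f ^ (j - i) * (g * f ^ i) = g * f ^ (j - i) * f ^ i := by
    conv_lhs => rw [h2]
    have hc : f ^ i * f ^ (j - i) = f ^ (j - i) * f ^ i := (Commute.pow_pow_self f i (j - i)).eq
    simp only [mul_assoc, mul_inv_cancel_left]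
    rw [hc]
  rw [← mul_assoc] at h3
  exact (mul_right_cancel h3).symm

/-- If `g` commutes with no positive power of `f`, then the positive half-orbits of `f` through
`x₀` and `g • x₀` diverge. -/
theorem exists_diverging_of_not_commute {δ : ℝ} (h4 : FourPoint X δ)
    (hiso : ∀ (g : G) (x y : X), dist (g • x) (g • y) = dist x y)
    {f g : G} {x₀ : X} (hf : ∀ m n : ℤ, dist ((f ^ m) • x₀) ((f ^ n) • x₀) = |(m : ℝ) - n|)
    (hwpd : WPD f x₀) (hg : ¬ ∃ k : ℕ, 0 < k ∧ Commute g (f ^ k)) :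
    ∃ T : ℝ, ∀ n m : ℕ, (n : ℝ) + m - T ≤ dist ((f ^ n) • x₀) ((g * f ^ m) • x₀) := by
  by_contra! hcon
  have hδ : 0 ≤ δ := by
    have := h4 x₀ x₀ x₀ x₀
    simp only [dist_self] at this
    rcases this with h | h <;> linarith
  have hfn : ∀ m n : ℕ, dist ((f ^ m) • x₀) ((f ^ n) • x₀) = |(m : ℝ) - n| := fun m n => by
    simpa using hf m n
  have hgfn : ∀ m n : ℕ, dist ((g * f ^ m) • x₀) ((g * f ^ n) • x₀) = |(m : ℝ) - n| := by
    intro m n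
    rw [mul_smul, mul_smul, hiso, hfn]
  apply hg
  refine exists_commute_pow_of_dist_le hiso hwpd (R := dist x₀ (g • x₀) + 2 * δ) fun j => ?_
  set κ := dist x₀ (g • x₀) with hκ
  have hκ0 : 0 ≤ κ := dist_nonneg
  obtain ⟨n, m, hnm⟩ := hcon (2 * j + κ + δ)
  have f0 : ∀ n : ℕ, dist x₀ ((f ^ n) • x₀) = n := fun n => by simpa using hfn 0 n
  have g0 : ∀ n : ℕ, dist (g • x₀) ((g * f ^ n) • x₀) = n := fun n => by simpa using hgfn 0 n
  have t1 := dist_triangle4 (g • x₀) x₀ ((f ^ n) • x₀) ((g * f ^ m) • x₀)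
  have t2 := dist_triangle4 x₀ (g • x₀) ((g * f ^ m) • x₀) ((f ^ n) • x₀)
  rw [dist_comm (g • x₀) x₀, g0, f0] at t1
  rw [g0, f0, dist_comm ((g * f ^ m) • x₀)] at t2
  have hjn : (j : ℝ) ≤ n := by linarith
  have hjm : (j : ℝ) ≤ m := by linarith
  have t3 := dist_triangle x₀ (g • x₀) ((g * f ^ m) • x₀)
  have t4 := dist_triangle (g • x₀) x₀ ((f ^ j) • x₀)
  rw [g0] at t3
  rw [dist_comm (g • x₀) x₀, f0] at t4
  have e1 : dist ((f ^ n) • x₀) ((f ^ j) • x₀) = n - j := by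
    rw [hfn, abs_of_nonneg (by linarith)]
  have e2 : dist ((g * f ^ m) • x₀) ((g * f ^ j) • x₀) = m - j := by
    rw [hgfn, abs_of_nonneg (by linarith)]
  have key : dist ((g * f ^ m) • x₀) ((f ^ j) • x₀) ≤ m - j + κ + δ := by
    have := h4 ((f ^ n) • x₀) x₀ ((g * f ^ m) • x₀) ((f ^ j) • x₀)
    rw [e1, f0, dist_comm _ x₀, f0] at this
    rcases this with h | h <;> linarith
  have := h4 (g • x₀) ((g * f ^ m) • x₀) ((f ^ j) • x₀) ((g * f ^ j) • x₀)
  rw [e2, g0, g0] at this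
  rcases this with h | h <;> linarith

/-- If `g` commutes with a positive power of `f`, then `g` moves the orbit of `f` within uniformly
bounded distance of a shift of itself. -/
theorem exists_zpow_dist_le_of_commute {δ : ℝ} (h4 : FourPoint X δ)
    (hiso : ∀ (g : G) (x y : X), dist (g • x) (g • y) = dist x y)
    {f g : G} {x₀ : X} (hf : ∀ m n : ℤ, dist ((f ^ m) • x₀) ((f ^ n) • x₀) = |(m : ℝ) - n|)
    {k : ℕ} (hk : 0 < k) (hcomm : Commute g (f ^ k)) (L : ℕ) :
    ∃ c : ℤ, dist ((f ^ c) • x₀) (g • x₀) ≤ 5 * δ + 1 ∧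
      dist ((f ^ (c + L)) • x₀) ((g * f ^ L) • x₀) ≤ 5 * δ + 1 := by
  have hδ : 0 ≤ δ := by
    have := h4 x₀ x₀ x₀ x₀
    simp only [dist_self] at this
    rcases this with h | h <;> linarith
  set κ := dist x₀ (g • x₀) with hκ
  have hκ0 : 0 ≤ κ := dist_nonneg
  obtain ⟨M, hM⟩ := exists_nat_gt (2 * κ + 2 * L + 3 * δ + 1)
  obtain ⟨N, hN, hcN⟩ : ∃ N : ℤ, 2 * κ + 2 * L + 3 * δ + 1 < (N : ℝ) ∧ Commute g (f ^ N) := by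
    refine ⟨k * M, ?_, ?_⟩
    · have h1 : (1 : ℝ) ≤ k := by exact_mod_cast hk
      have h2 : (0 : ℝ) ≤ M := by positivity
      push_cast
      nlinarith
    · rw [zpow_mul, zpow_natCast, zpow_natCast]
      exact hcomm.pow_right M
  have hgf : ∀ m n : ℤ, dist ((g * f ^ m) • x₀) ((g * f ^ n) • x₀) = |(m : ℝ) - n| := by
    intro m n
    rw [mul_smul, mul_smul, hiso, hf]
  have hshift : ∀ n : ℤ, Commute g (f ^ n) → dist ((f ^ n) • x₀) ((g * f ^ n) • x₀) = κ := by
    intro n hn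
    rw [hn.eq, mul_smul, hiso]
  have haa' := hshift (-N) (by rw [zpow_neg]; exact hcN.inv_right)
  have hbb' := hshift N hcN
  set a := (f ^ (-N)) • x₀ with ha
  set b := (f ^ N) • x₀ with hb
  set a' := (g * f ^ (-N)) • x₀ with ha'
  set b' := (g * f ^ N) • x₀ with hb'
  have hL0 : (0 : ℝ) ≤ L := by positivity
  have hab : dist a b = 2 * N := by
    rw [ha, hb, hf, abs_of_nonpos (by push_cast; linarith)]
    push_cast; ring
  have hab' : dist a' b' = 2 * N := by
    rw [ha', hb', hgf, abs_of_nonpos (by push_cast; linarith)]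
    push_cast; ring
  have hq : ∀ i : ℕ, i ≤ L → dist a' ((g * f ^ (i : ℤ)) • x₀) = N + i ∧
      dist ((g * f ^ (i : ℤ)) • x₀) b' = N - i := by
    intro i hi
    have hi' : (i : ℝ) ≤ L := by exact_mod_cast hi
    have hi0 : (0 : ℝ) ≤ i := by positivity
    constructor
    · rw [ha', hgf, abs_of_nonpos (by push_cast; linarith)]
      push_cast; ring
    · rw [hb', hgf, abs_of_nonpos (by push_cast; linarith)]
      push_cast; ring
  have hsum : ∀ i : ℕ, i ≤ L → dist ((g * f ^ (i : ℤ)) • x₀) a +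
      dist ((g * f ^ (i : ℤ)) • x₀) b ≤ 2 * N + 2 * δ := by
    intro i hi
    have hi' : (i : ℝ) ≤ L := by exact_mod_cast hi
    have hi0 : (0 : ℝ) ≤ i := by positivity
    obtain ⟨e1, e2⟩ := hq i hi
    set q := (g * f ^ (i : ℤ)) • x₀
    have t1 := dist_triangle a' a q
    have t2 := dist_nonneg (x := q) (y := b)
    rw [dist_comm a' a, dist_comm a q] at t1
    have s1 := h4 a' b' a q
    rw [dist_comm a' a, dist_comm b' q, dist_comm a q] at s1
    have s1' : dist q a + (N - i) ≤ dist b' a + δ := by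
      rcases s1 with h | h <;> linarith
    have s2 := h4 a b' b q
    rw [dist_comm b' q, dist_comm b q, dist_comm a q, dist_comm b' b, dist_comm a b'] at s2
    rcases s2 with h | h <;> linarith
  have hnear : ∀ (c : ℤ) (i : ℕ), i ≤ L → (c : ℝ) ≤ N → -(N : ℝ) ≤ c →
      |dist ((g * f ^ (i : ℤ)) • x₀) a - (N + c)| ≤ 1 + δ →
      dist ((f ^ c) • x₀) ((g * f ^ (i : ℤ)) • x₀) ≤ 5 * δ + 1 := by
    intro c i hi hc1 hc2 habs
    rw [abs_le] at habs
    have hs := hsum i hi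
    set q := (g * f ^ (i : ℤ)) • x₀
    have e1 : dist ((f ^ c) • x₀) a = N + c := by
      rw [ha, hf, abs_of_nonneg (by push_cast; linarith)]
      push_cast; ring
    have e2 : dist ((f ^ c) • x₀) b = N - c := by
      rw [hb, hf, abs_of_nonpos (by linarith)]
      ring
    have s := h4 ((f ^ c) • x₀) q a b
    rcases s with h | h <;> linarith
  have hp := hq 0 (Nat.zero_le _)
  have hp' := hq L le_rfl
  have hpp' : dist ((g * f ^ ((0 : ℕ) : ℤ)) • x₀) ((g * f ^ (L : ℤ)) • x₀) = L := by
    rw [hgf, abs_of_nonpos (by push_cast; linarith)]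
    push_cast; ring
  set p := (g * f ^ ((0 : ℕ) : ℤ)) • x₀ with hpdef
  set p' := (g * f ^ (L : ℤ)) • x₀ with hp'def
  have hpg : p = g • x₀ := by simp [hpdef]
  have t1 := dist_triangle a' a p
  have t2 := dist_triangle a a' p
  have t3 := dist_triangle p' p a
  rw [dist_comm a' a, dist_comm a p] at t1
  rw [dist_comm a p] at t2
  rw [dist_comm p' p] at t3
  have hlow : dist p a + L - δ ≤ dist p' a := by
    have s := h4 a' p' p a
    rw [dist_comm a' a, dist_comm p' p] at s
    rcases s with h | h <;> push_cast at * <;> linarith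
  have hfl1 := Int.floor_le (dist p a)
  have hfl2 := Int.lt_floor_add_one (dist p a)
  push_cast at hp
  refine ⟨⌊dist p a⌋ - N, ?_, ?_⟩
  · rw [← hpg]
    apply hnear _ 0 (Nat.zero_le _)
    · push_cast; linarith
    · push_cast; linarith
    · rw [abs_le, ← hpdef]; push_cast; constructor <;> linarith
  · rw [← zpow_natCast f L]
    apply hnear _ L le_rfl
    · push_cast; linarith
    · push_cast; linarith
    · rw [abs_le]; push_cast; constructor <;> linarith

/-- The subgroup of elements commuting with a positive power of `f`. -/
def powCentralizer (f : G) : Subgroup G where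
  carrier := {g | ∃ k : ℕ, 0 < k ∧ Commute g (f ^ k)}
  one_mem' := ⟨1, one_pos, Commute.one_left _⟩
  mul_mem' := by
    rintro a b ⟨k, hk, ha⟩ ⟨m, hm, hb⟩
    refine ⟨k * m, Nat.mul_pos hk hm, Commute.mul_left ?_ ?_⟩
    · rw [pow_mul]; exact ha.pow_right m
    · rw [mul_comm, pow_mul]; exact hb.pow_right k
  inv_mem' := by
    rintro a ⟨k, hk, ha⟩
    exact ⟨k, hk, ha.inv_left⟩

theorem infinite_quotient_powCentralizer {δ : ℝ} (h4 : FourPoint X δ)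
    (hiso : ∀ (g : G) (x y : X), dist (g • x) (g • y) = dist x y) (hnvc : ¬ VirtuallyCyclic G)
    {f : G} {x₀ : X} (hf : ∀ m n : ℤ, dist ((f ^ m) • x₀) ((f ^ n) • x₀) = |(m : ℝ) - n|)
    (hwpd : WPD f x₀) : Infinite (G ⧸ powCentralizer f) := by
  by_contra hfin
  rw [not_infinite_iff_finite] at hfin
  apply hnvc
  have hδ : 0 ≤ δ := by
    have := h4 x₀ x₀ x₀ x₀
    simp only [dist_self] at this
    rcases this with h | h <;> linarith
  obtain ⟨L, -, hF⟩ := hwpd (5 * δ + 2) (by linarith)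
  set F := {g : G | dist x₀ (g • x₀) < 5 * δ + 2 ∧
    dist ((f ^ L) • x₀) ((g * f ^ L) • x₀) < 5 * δ + 2} with hFdef
  have : Finite F := hF
  have hcover : ∀ g ∈ powCentralizer f, ∃ c : ℤ, (f ^ c)⁻¹ * g ∈ F := by
    rintro g ⟨k, hk, hc⟩
    obtain ⟨c, h1, h2⟩ := exists_zpow_dist_le_of_commute h4 hiso hf hk hc L
    refine ⟨c, ?_, ?_⟩
    · rw [← hiso (f ^ c), ← mul_smul, mul_inv_cancel_left]
      linarith
    · rw [← hiso (f ^ c), ← mul_smul, ← mul_smul, mul_assoc, mul_inv_cancel_left,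
        ← zpow_natCast f L, ← zpow_add, zpow_natCast]
      linarith
  have hsurj : Function.Surjective (fun q : (G ⧸ powCentralizer f) × F =>
      (QuotientGroup.mk (q.1.out * (q.2 : G)⁻¹) : G ⧸ Subgroup.zpowers f)) := by
    intro y
    obtain ⟨g, rfl⟩ := QuotientGroup.mk_surjective y
    have he : (QuotientGroup.mk g : G ⧸ powCentralizer f).out⁻¹ * g ∈ powCentralizer f := by
      rw [← QuotientGroup.eq, QuotientGroup.out_eq']
    obtain ⟨c, hc⟩ := hcover _ (inv_mem he)
    refine ⟨⟨QuotientGroup.mk g, ⟨_, hc⟩⟩, ?_⟩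
    rw [QuotientGroup.eq]
    refine ⟨-c, ?_⟩
    simp only [zpow_neg]
    group
  have := Finite.of_surjective _ hsurj
  exact ⟨Subgroup.zpowers f, Subgroup.finiteIndex_of_finite_quotient, inferInstance⟩

/-- There are three translates of the half-orbit of `f` which pairwise diverge. -/
theorem exists_three_diverging {δ : ℝ} (h4 : FourPoint X δ)
    (hiso : ∀ (g : G) (x y : X), dist (g • x) (g • y) = dist x y) (hnvc : ¬ VirtuallyCyclic G)
    {f : G} {x₀ : X} (hf : ∀ m n : ℤ, dist ((f ^ m) • x₀) ((f ^ n) • x₀) = |(m : ℝ) - n|)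
    (hwpd : WPD f x₀) :
    ∃ (g : Fin 3 → G) (T : ℝ), ∀ i j, i ≠ j → ∀ n m : ℕ,
      (n : ℝ) + m - T ≤ dist ((g i * f ^ n) • x₀) ((g j * f ^ m) • x₀) := by
  have := infinite_quotient_powCentralizer h4 hiso hnvc hf hwpd
  let e := Infinite.natEmbedding (G ⧸ powCentralizer f)
  let g : Fin 3 → G := fun i => (e i).out
  have hg : ∀ i j, i ≠ j → ∃ T : ℝ, ∀ n m : ℕ,
      (n : ℝ) + m - T ≤ dist ((g i * f ^ n) • x₀) ((g j * f ^ m) • x₀) := by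
    intro i j hij
    have hnot : (g i)⁻¹ * g j ∉ powCentralizer f := by
      rw [← QuotientGroup.eq, QuotientGroup.out_eq', QuotientGroup.out_eq']
      intro h
      exact hij (Fin.ext (e.injective h))
    obtain ⟨T, hT⟩ := exists_diverging_of_not_commute h4 hiso hf hwpd hnot
    refine ⟨T, fun n m => (hT n m).trans_eq ?_⟩
    rw [← hiso (g i), ← mul_smul, ← mul_smul, mul_assoc, mul_inv_cancel_left]
  choose! T hT using hg
  refine ⟨g, ∑ i, ∑ j, |T i j|, fun i j hij n m => le_trans ?_ (hT i j hij n m)⟩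
  have h1 : |T i j| ≤ ∑ j, |T i j| :=
    Finset.single_le_sum (f := fun j => |T i j|) (fun _ _ => abs_nonneg _) (Finset.mem_univ j)
  have h2 : ∑ j, |T i j| ≤ ∑ i, ∑ j, |T i j| :=
    Finset.single_le_sum (f := fun i => ∑ j, |T i j|)
      (fun _ _ => Finset.sum_nonneg fun _ _ => abs_nonneg _) (Finset.mem_univ i)
  linarith [le_abs_self (T i j)]

end Parallel

/-- In a finite forest in which every vertex has two descending sides, the number of sides with no
vertex below them is at least the number of vertices. Here `r a i b` says that `b` is below the
`i`-th side of `a`. -/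
theorem card_le_card_leaves {α : Type*} [DecidableEq α] (r : α → Bool → α → Prop) (depth : α → ℝ)
    (hdepth : ∀ a i b, r a i b → depth a < depth b) (B : Finset α)
    (hforest : ∀ a ∈ B, ∀ b ∈ B, ∀ i j, (a, i) ≠ (b, j) → ∀ c, r a i c → r b j c →
      r a i b ∨ r b j a) :
    ∃ Λ : Finset (α × Bool), B.card ≤ Λ.card ∧
      (∀ x ∈ Λ, x.1 ∈ B ∧ ∀ b ∈ B, ¬ r x.1 x.2 b) := by
  classical
  revert hforest
  induction B using Finset.induction_on_max_value depth with
  | empty => exact fun _ => ⟨∅, by simp⟩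
  | insert c s hc hmax ih =>
    intro hforest
    obtain ⟨Λ, hcard, hΛ⟩ := ih fun a ha b hb =>
      hforest a (Finset.mem_insert_of_mem ha) b (Finset.mem_insert_of_mem hb)
    have hone : (Λ.filter fun x => r x.1 x.2 c).card ≤ 1 := by
      rw [Finset.card_le_one]
      intro x hx y hy
      rw [Finset.mem_filter] at hx hy
      by_contra hxy
      obtain ⟨hxs, hx'⟩ := hΛ x hx.1
      obtain ⟨hys, hy'⟩ := hΛ y hy.1
      rcases hforest x.1 (Finset.mem_insert_of_mem hxs) y.1 (Finset.mem_insert_of_mem hys)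
        x.2 y.2 hxy c hx.2 hy.2 with h | h
      · exact hx' _ hys h
      · exact hy' _ hxs h
    have hsplit := Finset.card_filter_add_card_filter_not (s := Λ) (fun x => r x.1 x.2 c)
    have hdisj : Disjoint (Λ.filter fun x => ¬ r x.1 x.2 c)
        ({(c, false), (c, true)} : Finset (α × Bool)) := by
      rw [Finset.disjoint_left]
      intro x hx hx'
      have h1 := (hΛ x (Finset.mem_filter.1 hx).1).1
      have h2 : x.1 = c := by
        simp only [Finset.mem_insert, Finset.mem_singleton] at hx'
        rcases hx' with rfl | rfl <;> rfl
      exact hc (h2 ▸ h1)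
    refine ⟨(Λ.filter fun x => ¬ r x.1 x.2 c) ∪ {(c, false), (c, true)}, ?_, ?_⟩
    · rw [Finset.card_union_of_disjoint hdisj, Finset.card_insert_of_notMem hc,
        Finset.card_pair (by simp)]
      omega
    · intro x hx
      rw [Finset.mem_union, Finset.mem_filter] at hx
      rcases hx with ⟨hx, hxc⟩ | hx
      · refine ⟨Finset.mem_insert_of_mem (hΛ x hx).1, fun b hb => ?_⟩
        rcases Finset.mem_insert.1 hb with rfl | hb
        · exact hxc
        · exact (hΛ x hx).2 b hb
      · have h2 : x.1 = c := by
          simp only [Finset.mem_insert, Finset.mem_singleton] at hx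
          rcases hx with rfl | rfl <;> rfl
        rw [h2]
        refine ⟨Finset.mem_insert_self _ _, fun b hb hr => ?_⟩
        have := hdepth _ _ _ hr
        rcases Finset.mem_insert.1 hb with rfl | hb
        · exact lt_irrefl _ this
        · exact absurd (hmax b hb) (not_le.2 this)

section Rays

variable {X : Type*} [MetricSpace X]

/-- `u` lies within `c` of being between `o` and `z`: twice the Gromov product `(o|z)_u` is at
most `c`. -/
def AlmostBetween (c : ℝ) (o u z : X) : Prop := dist o u + dist u z ≤ dist o z + c

/-- A family of pairs of rays `r a i`, issuing from near `p a`, diverging from each other and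
pointing away from `o`, with all implied constants at most `K`. -/
structure OutwardRays {α : Type*} (K : ℝ) (o : X) (p : α → X) (r : α → Bool → ℕ → X) : Prop where
  dist_base : ∀ a i, dist (p a) (r a i 0) ≤ K
  dist_eq : ∀ a i n m, dist (r a i n) (r a i m) = |(n : ℝ) - m|
  diverge : ∀ a i j, i ≠ j → ∀ n m : ℕ, (n : ℝ) + m - K ≤ dist (r a i n) (r a j m)
  outward : ∀ a i, ∀ n : ℕ, dist o (p a) + n - K ≤ dist o (r a i n)

theorem AlmostBetween.dist_le {K c : ℝ} (h4 : FourPoint X K) {o u v z : X}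
    (hu : AlmostBetween c o u z) (hv : AlmostBetween c o v z) :
    dist u v ≤ |dist o u - dist o v| + c + K := by
  unfold AlmostBetween at hu hv
  have h := h4 u v o z
  rw [dist_comm u o, dist_comm v o] at h
  rcases h with h | h
  · linarith [le_abs_self (dist o u - dist o v)]
  · linarith [neg_abs_le (dist o u - dist o v)]

/-- If `p` is almost between `o` and both `w` and `z`, and `u` is almost between `o` and `w` but
much closer to `o` than `p`, then `u` is almost between `o` and `z`, with a constant which does
not depend on that for `p`. -/
theorem AlmostBetween.transfer {K c κ : ℝ} (h4 : FourPoint X K) {o u p w z : X}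
    (hc : 0 ≤ c) (hpz : AlmostBetween κ o p z) (hpw : AlmostBetween κ o p w)
    (huw : AlmostBetween c o u w) (hκ : 0 ≤ κ) (hK : 0 ≤ K)
    (hgap : dist o u + κ + K < dist o p) : AlmostBetween (c + 2 * K) o u z := by
  unfold AlmostBetween at *
  have h1 : dist u p ≤ dist o p - dist o u + c + K := by
    have h := h4 u p o w
    rw [dist_comm u o, dist_comm p o] at h
    rcases h with h | h
    · linarith [dist_nonneg (x := u) (y := p)]
    · linarith
  have h := h4 u z o p
  rw [dist_comm u o, dist_comm z p, dist_comm z o] at h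
  rcases h with h | h <;> linarith

namespace OutwardRays

variable {α : Type*} {K : ℝ} {o : X} {p : α → X} {r : α → Bool → ℕ → X}

theorem dist_le (h : OutwardRays K o p r) (a : α) (i : Bool) (n : ℕ) :
    dist o (r a i n) ≤ dist o (p a) + n + K := by
  have h1 := dist_triangle4 o (p a) (r a i 0) (r a i n)
  have h2 := h.dist_base a i
  have h3 := h.dist_eq a i 0 n
  simp only [Nat.cast_zero, zero_sub, abs_neg, Nat.abs_cast] at h3
  linarith

theorem almostBetween (h : OutwardRays K o p r) (h4 : FourPoint X K) {a : α} {i : Bool} {D : ℕ}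
    {z : X} (hz : dist z (r a i D) < dist z (r a i 0)) {s : ℕ} (hs : 2 * (s : ℝ) + 3 * K < D)
    (hK : 0 ≤ K) : AlmostBetween (3 * K) o (r a i s) z := by
  unfold AlmostBetween
  have h1 := h.outward a i D
  have h2 := h.dist_le a i s
  have hs0 : (0 : ℝ) ≤ s := Nat.cast_nonneg s
  have h3 : dist (r a i s) (r a i D) = D - s := by
    rw [h.dist_eq, abs_of_nonpos (by linarith)]; ring
  have h5 : dist (r a i s) (r a i 0) = s := by
    rw [h.dist_eq]; simp
  have h6 := dist_triangle z (r a i s) (r a i 0)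
  rw [dist_comm z (r a i s)] at h6
  have h7 := h4 o (r a i D) z (r a i s)
  rw [dist_comm z (r a i s), dist_comm (r a i D) (r a i s), dist_comm (r a i D) z] at h7
  rcases h7 with h7 | h7 <;> linarith

theorem almostBetween_base (h : OutwardRays K o p r) (h4 : FourPoint X K) {a : α} {i : Bool}
    {D : ℕ} {z : X} (hz : dist z (r a i D) < dist z (r a i 0)) (hD : 3 * K < D) (hK : 0 ≤ K) :
    AlmostBetween (7 * K) o (p a) z := by
  have h1 := h.almostBetween h4 hz (s := 0) (by simpa using hD) hK
  unfold AlmostBetween at *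
  have h2 := h.dist_base a i
  have h3 := dist_triangle o (r a i 0) (p a)
  have h5 := dist_triangle (p a) (r a i 0) z
  rw [dist_comm (r a i 0) (p a)] at h3
  linarith

/-- Two distinct rays of the family which start at almost the same depth cannot both be followed
by a geodesic from `o`. -/
theorem false_of_almostBetween (h : OutwardRays K o p r) (h4 : FourPoint X K) (hK : 1 ≤ K)
    {L s₁ D : ℕ} {Δ : ℝ} (hs₁ : 5 * K < s₁) (hΔD : Δ ≤ D) {a b : α} {i j : Bool}
    (hsep : a ≠ b → ∀ m : ℕ, m ≤ D → dist (r a i m) (r b j 0) < 10 * K →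
      10 * K ≤ dist (r a i (m + L)) (r b j L))
    (hab : (a, i) ≠ (b, j)) {z : X}
    (ha : ∀ s : ℕ, (s : ℝ) ≤ Δ + L + s₁ → AlmostBetween (5 * K) o (r a i s) z)
    (hb : ∀ s : ℕ, (s : ℝ) ≤ L + s₁ → AlmostBetween (5 * K) o (r b j s) z)
    (hle : dist o (p a) ≤ dist o (p b)) (hΔ : dist o (p b) ≤ dist o (p a) + Δ) : False := by
  set m := ⌊dist o (p b) - dist o (p a)⌋₊ with hm
  have hm1 : (m : ℝ) ≤ dist o (p b) - dist o (p a) := Nat.floor_le (by linarith)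
  have hm2 : dist o (p b) - dist o (p a) < m + 1 := Nat.lt_floor_add_one _
  have hclose : ∀ s : ℕ, (s : ℝ) ≤ L + s₁ → dist (r a i (m + s)) (r b j s) ≤ 9 * K := by
    intro s hs
    have h1 := (ha (m + s) (by push_cast; linarith)).dist_le h4 (hb s hs)
    have h2 := h.outward a i (m + s)
    have h3 := h.dist_le a i (m + s)
    have h5 := h.outward b j s
    have h6 := h.dist_le b j s
    push_cast at h2 h3
    have : |dist o (r a i (m + s)) - dist o (r b j s)| ≤ 3 * K := by
      rw [abs_le]; constructor <;> linarith
    linarith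
  have hL0 : (0 : ℝ) ≤ L := Nat.cast_nonneg L
  have hs0 : (0 : ℝ) ≤ s₁ := Nat.cast_nonneg s₁
  by_cases hne : a = b
  · subst hne
    have hij : i ≠ j := fun e => hab (by rw [e])
    have h1 := hclose s₁ (by linarith)
    have h2 := h.diverge a i j hij (m + s₁) s₁
    have hm0 : (0 : ℝ) ≤ m := Nat.cast_nonneg m
    push_cast at h2
    linarith
  · have hmD : m ≤ D := by
      have : (m : ℝ) ≤ D := by linarith
      exact_mod_cast this
    have h1 := hclose 0 (by push_cast; linarith)
    have h2 := hclose L (by linarith)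
    have := hsep hne m hmD (by rw [add_zero] at h1; linarith)
    linarith

/-- If, from every point `p a` with `a ∈ B`, both of the half-spaces cut out by the rays from `a`
contain at least `M` points of `P`, and the rays do not fellow-travel, then `P` has at least
`M * #B` points. -/
theorem card_mul_le (h : OutwardRays K o p r) (h4 : FourPoint X K) (hK : 1 ≤ K) {L s₁ D : ℕ}
    (hs₁ : 5 * K < s₁) (hD : 4 * (L + s₁) + 23 * K < D) (B : Finset α)
    (hsep : ∀ a ∈ B, ∀ b ∈ B, a ≠ b → ∀ i j, ∀ m : ℕ, m ≤ D →
      dist (r a i m) (r b j 0) < 10 * K → 10 * K ≤ dist (r a i (m + L)) (r b j L))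
    (P : Finset X) (M : ℕ)
    (hM : ∀ a ∈ B, ∀ i, M ≤ ({z | z ∈ P ∧ dist z (r a i D) < dist z (r a i 0)} : Set X).ncard) :
    M * B.card ≤ P.card := by
  classical
  have hL0 : (0 : ℝ) ≤ L := Nat.cast_nonneg L
  have hs0 : (0 : ℝ) ≤ s₁ := Nat.cast_nonneg s₁
  have hK0 : 0 ≤ K := by linarith
  obtain ⟨Δ, hΔ⟩ : ∃ Δ : ℝ, Δ = L + s₁ + 10 * K := ⟨_, rfl⟩
  let V : α × Bool → Finset X := fun x =>
    P.filter fun z => dist z (r x.1 x.2 D) < dist z (r x.1 x.2 0)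
  let below : α → Bool → α → Prop := fun a i b =>
    dist o (p a) + Δ < dist o (p b) ∧
      ∃ z, dist z (r a i D) < dist z (r a i 0) ∧ AlmostBetween (7 * K) o (p b) z
  have hmono : ∀ {c c' : ℝ} {u z : X}, c ≤ c' → AlmostBetween c o u z →
      AlmostBetween c' o u z := fun hc hu => le_trans hu (by linarith)
  have hfollow : ∀ {a i z} (s : ℕ), dist z (r a i D) < dist z (r a i 0) →
      (s : ℝ) ≤ Δ + L + s₁ → AlmostBetween (5 * K) o (r a i s) z := by
    intro a i z s hz hs
    exact hmono (by linarith) (h.almostBetween h4 hz (by linarith) hK0)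
  have hcompare : ∀ a ∈ B, ∀ b ∈ B, ∀ i j, (a, i) ≠ (b, j) → dist o (p a) ≤ dist o (p b) →
      ∀ c, below a i c → below b j c → below a i b := by
    rintro a ha b hb i j hab hle c ⟨hac, z, hz, hcz⟩ ⟨hbc, w, hw, hcw⟩
    refine ⟨?_, z, hz, ?_⟩
    · by_contra hcon
      refine h.false_of_almostBetween h4 hK hs₁ (by linarith)
        (fun hne => hsep a ha b hb hne i j) hab (fun s hs => hfollow s hz hs)
        (fun s hs => ?_) hle (not_lt.1 hcon)
      have h1 := h.almostBetween h4 hw (s := s) (by linarith) hK0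
      have h2 := h.dist_le b j s
      exact hmono (by linarith) (AlmostBetween.transfer h4 (by linarith) hcz hcw h1
        (by linarith) hK0 (by linarith))
    · have h1 : AlmostBetween (5 * K) o (p b) w := by
        have h0 := h.almostBetween h4 hw (s := 0) (by push_cast; linarith) hK0
        unfold AlmostBetween at *
        have h2 := h.dist_base b j
        have h3 := dist_triangle o (r b j 0) (p b)
        have h5 := dist_triangle (p b) (r b j 0) w
        rw [dist_comm (r b j 0) (p b)] at h3
        linarith
      exact hmono (by linarith) (AlmostBetween.transfer h4 (by linarith) hcz hcw h1
        (by linarith) hK0 (by linarith))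
  obtain ⟨Λ, hcard, hΛ⟩ := card_le_card_leaves below (fun a => dist o (p a))
    (fun a i b hab => by linarith [hab.1]) B (by
      intro a ha b hb i j hab c hac hbc
      rcases le_total (dist o (p a)) (dist o (p b)) with hle | hle
      · exact Or.inl (hcompare a ha b hb i j hab hle c hac hbc)
      · exact Or.inr (hcompare b hb a ha j i hab.symm hle c hbc hac))
  have hmeet : ∀ a ∈ B, ∀ b ∈ B, ∀ i j, (a, i) ≠ (b, j) → dist o (p a) ≤ dist o (p b) →
      ∀ z, dist z (r a i D) < dist z (r a i 0) → dist z (r b j D) < dist z (r b j 0) →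
      below a i b := by
    intro a ha b hb i j hab hle z hza hzb
    refine ⟨?_, z, hza, h.almostBetween_base h4 hzb (by linarith) hK0⟩
    by_contra hcon
    exact h.false_of_almostBetween h4 hK hs₁ (by linarith)
      (fun hne => hsep a ha b hb hne i j) hab (fun s hs => hfollow s hza hs)
      (fun s hs => hfollow s hzb (by linarith)) hle (not_lt.1 hcon)
  have hdisj : (Λ : Set (α × Bool)).PairwiseDisjoint V := by
    intro x hx y hy hxy
    obtain ⟨hxB, hx'⟩ := hΛ x hx
    obtain ⟨hyB, hy'⟩ := hΛ y hy
    rw [Function.onFun, Finset.disjoint_left]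
    intro z hzx hzy
    have hzx' := (Finset.mem_filter.1 hzx).2
    have hzy' := (Finset.mem_filter.1 hzy).2
    rcases le_total (dist o (p x.1)) (dist o (p y.1)) with hle | hle
    · exact hx' _ hyB (hmeet _ hxB _ hyB _ _ hxy hle z hzx' hzy')
    · exact hy' _ hxB (hmeet _ hyB _ hxB _ _ hxy.symm hle z hzy' hzx')
  have hVM : ∀ x ∈ Λ, M ≤ (V x).card := by
    intro x hx
    have := hM x.1 (hΛ x hx).1 x.2
    rwa [show ({z | z ∈ P ∧ dist z (r x.1 x.2 D) < dist z (r x.1 x.2 0)} : Set X) = ↑(V x) by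
      ext z; simp [V], Set.ncard_coe_finset] at this
  calc M * B.card ≤ M * Λ.card := Nat.mul_le_mul_left _ hcard
    _ = ∑ _x ∈ Λ, M := by rw [Finset.sum_const, smul_eq_mul, mul_comm]
    _ ≤ ∑ x ∈ Λ, (V x).card := Finset.sum_le_sum hVM
    _ = (Λ.biUnion V).card := (Finset.card_biUnion hdisj).symm
    _ ≤ P.card := Finset.card_le_card (Finset.biUnion_subset.2 fun x _ => Finset.filter_subset _ _)

end OutwardRays

/-- Among three rays diverging from each other, at least two point away from `o`. -/
theorem exists_pair_outward {K : ℝ} (h4 : FourPoint X K) (o p : X) (r : Fin 3 → ℕ → X)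
    (hp : ∀ i n, dist p (r i n) ≤ n + K)
    (hr : ∀ i j, i ≠ j → ∀ n m : ℕ, (n : ℝ) + m - K ≤ dist (r i n) (r j m)) :
    ∃ c : Bool → Fin 3, Function.Injective c ∧
      ∀ i, ∀ n : ℕ, dist o p + n - 3 * K ≤ dist o (r (c i) n) := by
  obtain ⟨i₀, hi₀⟩ : ∃ i₀, ∀ i, i ≠ i₀ → ∀ n : ℕ, dist o p + n - 3 * K ≤ dist o (r i n) := by
    by_contra! hcon
    obtain ⟨i, -, n, hn⟩ := hcon 0
    obtain ⟨j, hj, m, hm⟩ := hcon i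
    have h1 := hr i j hj.symm n m
    have h2 := hp i n
    have h3 := hp j m
    have h5 := h4 (r i n) (r j m) o p
    rw [dist_comm (r i n) o, dist_comm (r i n) p, dist_comm (r j m) o, dist_comm (r j m) p] at h5
    rcases h5 with h5 | h5 <;> linarith
  refine ⟨fun b => if b then i₀ + 1 else i₀ + 2, ?_, ?_⟩
  · clear hi₀
    revert i₀
    unfold Function.Injective
    decide
  · intro i
    apply hi₀
    clear hi₀
    revert i₀ i
    decide

end Rays

/-- A finite subset of a group contains a `Φ`-separated subset of proportion at least
`1 / (2 * #Φ + 1)`. -/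
theorem exists_separated_subset {G : Type*} [Group G] (Φ B : Finset G) :
    ∃ C ⊆ B, (∀ a ∈ C, ∀ b ∈ C, a ≠ b → a⁻¹ * b ∉ Φ) ∧
      B.card ≤ (2 * Φ.card + 1) * C.card := by
  classical
  let Ψ : Finset G := insert 1 (Φ ∪ Φ.image (·⁻¹))
  have hΨ : Ψ.card ≤ 2 * Φ.card + 1 := by
    refine (Finset.card_insert_le _ _).trans ?_
    have h1 := Finset.card_union_le Φ (Φ.image (·⁻¹))
    have h2 := Finset.card_image_le (s := Φ) (f := (·⁻¹))
    omega
  induction B using Finset.strongInduction with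
  | H B ih =>
    rcases B.eq_empty_or_nonempty with rfl | ⟨b, hb⟩
    · exact ⟨∅, by simp⟩
    · have hlt : B.filter (fun x => b⁻¹ * x ∉ Ψ) ⊂ B :=
        Finset.filter_ssubset.2 ⟨b, hb, by simp [Ψ]⟩
      obtain ⟨C, hCB, hsep, hcard⟩ := ih _ hlt
      have hC : ∀ x ∈ C, b⁻¹ * x ∉ Ψ := fun x hx => (Finset.mem_filter.1 (hCB hx)).2
      have hbC : b ∉ C := fun h => hC b h (by simp [Ψ])
      refine ⟨insert b C, ?_, ?_, ?_⟩
      · exact Finset.insert_subset hb (hCB.trans (Finset.filter_subset _ _))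
      · intro x hx y hy hxy hmem
        rcases Finset.mem_insert.1 hx with hx' | hx' <;>
          rcases Finset.mem_insert.1 hy with hy' | hy'
        · exact hxy (hx'.trans hy'.symm)
        · exact hC y hy' (by simp [Ψ, ← hx', hmem])
        · subst hy'
          refine hC x hx' ?_
          simp only [Ψ, Finset.mem_insert, Finset.mem_union, Finset.mem_image]
          exact Or.inr (Or.inr ⟨_, hmem, by group⟩)
        · exact hsep x hx' y hy' hxy hmem
      · have hle : (B.filter fun x => ¬ (b⁻¹ * x ∉ Ψ)).card ≤ Ψ.card := by
          refine Finset.card_le_card_of_injOn (fun x => b⁻¹ * x) ?_ ?_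
          · intro x hx
            simpa using (Finset.mem_filter.1 hx).2
          · intro x _ y _ hxy
            exact mul_left_cancel hxy
        have hsplit := Finset.card_filter_add_card_filter_not (s := B) (fun x => b⁻¹ * x ∉ Ψ)
        rw [Finset.card_insert_of_notMem hbC, Nat.mul_add, mul_one]
        omega

/-- **Weak supporting hyperplane lemma** for WPD actions on Gromov hyperbolic spaces. -/
theorem weak_supporting_hyperplane
    {X : Type*} [MetricSpace X] {G : Type*} [Group G] [MulAction G X]
    (δ : ℝ) (hX : GromovHyperbolic X δ)
    (hiso : ∀ (g : G) (x y : X), dist (g • x) (g • y) = dist x y)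
    (hnvc : ¬ VirtuallyCyclic G)
    (f : G) (ℓ : ℝ → X) (hgeo : ∀ s t : ℝ, dist (ℓ s) (ℓ t) = |s - t|)
    (haxis : ∀ t : ℝ, f • ℓ t = ℓ (t + 1))
    (x₀ : X) (hx₀ : x₀ ∈ Set.range ℓ) (hwpd : WPD f x₀)
    (S : Finset G) (hgen : Subgroup.closure (S : Set G) = ⊤) :
    ∃ D₀ : ℝ, 0 < D₀ ∧ ∀ ε : ℝ, 0 < ε → ∀ D : ℤ, D₀ < (D : ℝ) →
      ∃ N : ℕ, ∀ A : Finset G,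
        ∃ A' : Finset G, A' ⊆ A ∧ (1 - ε) * (A.card : ℝ) ≤ (A'.card : ℝ) ∧
          ∀ a ∈ A', ∃ b : G, wordDist S a b ≤ N ∧
            (((fun g : G => g • x₀) '' (A : Set G)) \
                halfspace (b • x₀) ((b * f ^ D) • x₀)).ncard ≤ N := by
  classical
  obtain ⟨t₀, ht₀⟩ := hx₀
  have hpow : ∀ (n : ℕ) (t : ℝ), (f ^ n) • ℓ t = ℓ (t + n) := by
    intro n
    induction n with
    | zero => intro t; simp
    | succ n ih =>
      intro t
      rw [pow_succ, mul_smul, haxis, ih]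
      push_cast
      ring_nf
  have hzpow : ∀ (n : ℤ) (t : ℝ), (f ^ n) • ℓ t = ℓ (t + n) := by
    intro n t
    obtain ⟨k, rfl | rfl⟩ := n.eq_nat_or_neg
    · simpa using hpow k t
    · rw [zpow_neg, inv_smul_eq_iff, zpow_natCast, hpow]
      push_cast
      ring_nf
  have hf : ∀ m n : ℤ, dist ((f ^ m) • x₀) ((f ^ n) • x₀) = |(m : ℝ) - n| := by
    intro m n
    rw [← ht₀, hzpow, hzpow, hgeo]
    ring_nf
  have h4 := hX.fourPoint
  obtain ⟨g, T, hT⟩ := exists_three_diverging h4 hiso hnvc hf hwpd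
  obtain ⟨K₀, hK₀⟩ : ∃ K₀ : ℝ, K₀ = 1 + |6 * δ| + |T| + ∑ i, dist x₀ (g i • x₀) := ⟨_, rfl⟩
  have hsum0 : 0 ≤ ∑ i, dist x₀ (g i • x₀) := Finset.sum_nonneg fun _ _ => dist_nonneg
  have hgK : ∀ i, dist x₀ (g i • x₀) ≤ K₀ := by
    intro i
    have := Finset.single_le_sum (f := fun i => dist x₀ (g i • x₀)) (fun _ _ => dist_nonneg)
      (Finset.mem_univ i)
    linarith [abs_nonneg (6 * δ), abs_nonneg T]
  have hK1 : 1 ≤ K₀ := by linarith [abs_nonneg (6 * δ), abs_nonneg T]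
  have hKδ : 6 * δ ≤ K₀ := by linarith [le_abs_self (6 * δ), abs_nonneg T]
  have hKT : T ≤ K₀ := by linarith [abs_nonneg (6 * δ), le_abs_self T]
  have hray : ∀ (a : G) (n m : ℕ), dist ((a * f ^ n) • x₀) ((a * f ^ m) • x₀) = |(n : ℝ) - m| := by
    intro a n m
    rw [mul_smul, mul_smul, hiso]
    simpa using hf n m
  have hpair : ∀ a : G, ∃ c : Bool → Fin 3, Function.Injective c ∧ ∀ i, ∀ n : ℕ,
      dist x₀ (a • x₀) + n - 3 * K₀ ≤ dist x₀ ((a * g (c i) * f ^ n) • x₀) := by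
    intro a
    refine exists_pair_outward (h4.mono hKδ) x₀ (a • x₀)
      (fun i n => (a * g i * f ^ n) • x₀) (fun i n => ?_) (fun i j hij n m => ?_)
    · have h1 := dist_triangle (a • x₀) ((a * g i) • x₀) ((a * g i * f ^ n) • x₀)
      have h2 := hray (a * g i) 0 n
      rw [pow_zero, mul_one, Nat.cast_zero, zero_sub, abs_neg, Nat.abs_cast] at h2
      rw [mul_smul a (g i), hiso] at h1
      rw [mul_smul a (g i)] at h2
      linarith [hgK i]
    · have := hT i j hij n m
      rw [mul_assoc, mul_assoc, mul_smul, mul_smul a, hiso]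
      linarith
  choose c hcinj hcout using hpair
  have hrays : OutwardRays (3 * K₀) x₀ (fun a : G => a • x₀)
      (fun a i n => (a * g (c a i) * f ^ n) • x₀) := by
    refine ⟨fun a i => ?_, fun a i n m => hray _ n m, fun a i j hij n m => ?_, hcout⟩
    · rw [pow_zero, mul_one, mul_smul, hiso]
      linarith [hgK (c a i)]
    · have := hT _ _ (fun e => hij (hcinj a e)) n m
      rw [mul_assoc, mul_assoc, mul_smul, mul_smul a, hiso]
      linarith
  obtain ⟨L, -, hF⟩ := hwpd (10 * (3 * K₀)) (by linarith)
  obtain ⟨s₁, hs₁⟩ := exists_nat_gt (5 * (3 * K₀))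
  refine ⟨4 * (L + s₁) + 23 * (3 * K₀), by positivity, fun ε hε D hD => ?_⟩
  have hD0 : 0 ≤ D := by
    have : (0 : ℝ) < D := lt_trans (by positivity) hD
    exact_mod_cast this.le
  lift D to ℕ using hD0
  rw [Int.cast_natCast] at hD
  let Φ : Finset G := (Finset.univ ×ˢ Finset.univ ×ˢ Finset.range (D + 1) ×ˢ hF.toFinset).image
    fun q : Fin 3 × Fin 3 × ℕ × G => g q.1 * f ^ q.2.2.1 * q.2.2.2 * (g q.2.1)⁻¹
  obtain ⟨n₀, hn₀⟩ := exists_nat_gt ((2 * Φ.card + 1) / ε)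
  obtain ⟨N, hN₀, hNg⟩ : ∃ N : ℕ, n₀ ≤ N ∧ ∀ i, wordNorm S (g i) ≤ N :=
    ⟨n₀ + ∑ i, wordNorm S (g i), Nat.le_add_right _ _, fun i =>
      (Finset.single_le_sum (f := fun i => wordNorm S (g i)) (fun _ _ => Nat.zero_le _)
        (Finset.mem_univ i)).trans (Nat.le_add_left _ _)⟩
  refine ⟨N, fun A => ?_⟩
  let good : G → Prop := fun a => ∃ b : G, wordDist S a b ≤ N ∧
    (((fun g : G => g • x₀) '' (A : Set G)) \
      halfspace (b • x₀) ((b * f ^ (D : ℤ)) • x₀)).ncard ≤ N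
  refine ⟨A.filter good, Finset.filter_subset _ _, ?_, fun a ha => (Finset.mem_filter.1 ha).2⟩
  obtain ⟨C, hCB, hsep, hcard⟩ := exists_separated_subset Φ (A.filter fun a => ¬ good a)
  have hmain : N * C.card ≤ (A.image fun g => g • x₀).card := by
    refine hrays.card_mul_le (h4.mono (by linarith)) (by linarith) (L := L) hs₁ hD C ?_ _ N ?_
    · intro a ha b hb hab i j m hm h1
      by_contra! h2
      refine hsep a ha b hb hab (Finset.mem_image.2
        ⟨⟨c a i, c b j, m, (a * g (c a i) * f ^ m)⁻¹ * (b * g (c b j))⟩, ?_, by group⟩)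
      simp only [Finset.mem_product, Finset.mem_univ, true_and, Finset.mem_range,
        Set.Finite.mem_toFinset]
      refine ⟨by omega, ?_, ?_⟩
      · rw [← hiso (a * g (c a i) * f ^ m), ← mul_smul, mul_inv_cancel_left]
        simpa using h1
      · rw [← hiso (a * g (c a i) * f ^ m), ← mul_smul, ← mul_smul, mul_assoc _⁻¹,
          mul_inv_cancel_left, mul_assoc _ (f ^ m), ← pow_add]
        exact h2
    · intro a ha i
      have hbad := (Finset.mem_filter.1 (hCB ha)).2
      have h1 : ¬ _ ≤ N := fun h => hbad ⟨a * g (c a i), by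
        rw [wordDist, inv_mul_cancel_left]; exact hNg _, h⟩
      refine (not_le.1 h1).le.trans_eq (congrArg Set.ncard ?_)
      ext z
      simp [halfspace]
  have hPA : (A.image fun g => g • x₀).card ≤ A.card := Finset.card_image_le
  have hsplit := Finset.card_filter_add_card_filter_not (s := A) good
  have e1 : (N : ℝ) * C.card ≤ A.card := by exact_mod_cast hmain.trans hPA
  have e2 : ((A.filter fun a => ¬ good a).card : ℝ) ≤ (2 * Φ.card + 1) * C.card := by
    exact_mod_cast hcard
  have e3 : ((A.filter good).card : ℝ) + (A.filter fun a => ¬ good a).card = A.card := by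
    exact_mod_cast hsplit
  have e4 : (2 * Φ.card + 1 : ℝ) ≤ N * ε := by
    rw [← div_le_iff₀ hε]
    exact hn₀.le.trans (by exact_mod_cast hN₀)
  have e5 : (2 * Φ.card + 1 : ℝ) * C.card ≤ ε * A.card := by
    calc (2 * Φ.card + 1 : ℝ) * C.card ≤ N * ε * C.card := by gcongr
      _ = ε * (N * C.card) := by ring
      _ ≤ ε * A.card := by gcongr
  linarith
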